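/- arXiv:1712.07090 — 2 statements merged into one kernel-verified Lean document; each statement's English description precedes it below -/
import Mathlib

section
/- Let X and Y be infinite dimensional Banach spaces, with X having a normalized unconditional Schauder basis (x_n), and let m ∈ ℕ, q > 0, p ≥ 1. Suppose Y finitely factors the formal inclusion ℓ_p → ℓ_∞ for some 0 < δ < 1, and suppose every continuous m-homogeneous polynomial from X into Y is absolutely (q;1)-summing. Then: (a) if q < p, then for every t > pq/(p−q) and every x = ∑_j a_j x_j ∈ X one has ∑_j |a_j|^{mt} < ∞; (b) if q ≤ p/2, then for every t > q and every x = ∑_j a_j x_j ∈ X one has ∑_j |a_j|^{mt} < ∞. -/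
open scoped BigOperators

/-- A sequence in a normed space is *weakly 1-summable*. -/
def WeaklySummable (𝕂 : Type*) [RCLike 𝕂] {X : Type*} [NormedAddCommGroup X]
    [NormedSpace 𝕂 X] (x : ℕ → X) : Prop :=
  ∀ φ : X →L[𝕂] 𝕂, Summable fun j => ‖φ (x j)‖

/-- `P` is a continuous `m`-homogeneous polynomial. -/
def IsHomogPoly (𝕂 : Type*) [RCLike 𝕂] {X Y : Type*} [NormedAddCommGroup X] [NormedSpace 𝕂 X]
    [NormedAddCommGroup Y] [NormedSpace 𝕂 Y] (m : ℕ) (P : X → Y) : Prop :=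
  ∃ T : ContinuousMultilinearMap 𝕂 (fun _ : Fin m => X) Y, ∀ x, P x = T fun _ => x

/-- `e` is a normalized unconditional Schauder basis of `X`. -/
def IsNormalizedUncondBasis (𝕂 : Type*) [RCLike 𝕂] (X : Type*) [NormedAddCommGroup X]
    [NormedSpace 𝕂 X] (e : ℕ → X) : Prop :=
  (∀ n, ‖e n‖ = 1) ∧
  (∀ x : X, ∃! a : ℕ → 𝕂, HasSum (fun n => a n • e n) x) ∧
  ∃ ρ : ℝ, 1 ≤ ρ ∧ ∀ (a ε : ℕ → 𝕂) (x y : X),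
    (∀ n, ε n = 1 ∨ ε n = -1) →
    HasSum (fun n => a n • e n) x → HasSum (fun n => (ε n * a n) • e n) y →
    ‖y‖ ≤ ρ * ‖x‖

/-- `Y` finitely factors the formal inclusion `ℓ_p → ℓ_∞` for `δ`. -/
def FinitelyFactorsLpLinf (𝕂 : Type*) [RCLike 𝕂] (Y : Type*) [NormedAddCommGroup Y]
    [NormedSpace 𝕂 Y] (p δ : ℝ) : Prop :=
  ∀ n : ℕ, ∃ y : Fin n → Y, ∀ a : Fin n → 𝕂,
    (1 - δ) * (⨆ j, ‖a j‖) ≤ ‖∑ j, a j • y j‖ ∧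
    ‖∑ j, a j • y j‖ ≤ (∑ j, ‖a j‖ ^ p) ^ (1 / p)


/-- The coefficient functionals of a normalized unconditional basis are linear and uniformly
bounded, as one sees by changing a single sign. -/
theorem IsNormalizedUncondBasis.exists_coord {𝕂 : Type*} [RCLike 𝕂] {X : Type*}
    [NormedAddCommGroup X] [NormedSpace 𝕂 X] {e : ℕ → X} (he : IsNormalizedUncondBasis 𝕂 X e) :
    ∃ (c : ℕ → X →L[𝕂] 𝕂) (ρ : ℝ), 0 ≤ ρ ∧ (∀ j x, ‖c j x‖ ≤ ρ * ‖x‖) ∧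
      (∀ (x : X) (a : ℕ → 𝕂), HasSum (fun j => a j • e j) x → ∀ j, c j x = a j) ∧
      ∀ x, HasSum (fun j => c j x • e j) x := by
  obtain ⟨hnorm, hex, ρ, hρ, hsign⟩ := he
  choose a ha hau using hex
  have hbound : ∀ j x, ‖a x j‖ ≤ ρ * ‖x‖ := by
    intro j x
    have hy : HasSum (fun n => ((if n = j then -1 else 1 : 𝕂) * a x n) • e n)
        (x - (2 * a x j) • e j) := by
      have h1 := (ha x).sub (hasSum_ite_eq j ((2 * a x j) • e j))
      convert h1 using 2 with n
      split_ifs with h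
      · subst h
        rw [← sub_smul]; congr 1; ring
      · simp
    have h := hsign (a x) _ x _ (fun n => by by_cases h : n = j <;> simp [h]) (ha x) hy
    have h2 : ‖(2 * a x j) • e j‖ = 2 * ‖a x j‖ := by
      rw [norm_smul, hnorm, norm_mul, RCLike.norm_two, mul_one]
    have h3 : ‖(2 * a x j) • e j‖ ≤ ‖x‖ + ‖x - (2 * a x j) • e j‖ := by
      have := norm_sub_le x (x - (2 * a x j) • e j)
      simpa using this
    nlinarith [norm_nonneg x]
  let f : ℕ → X →ₗ[𝕂] 𝕂 := fun j =>
    { toFun := fun x => a x j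
      map_add' := fun x y => by
        have := hau (x + y) (fun n => a x n + a y n)
          (by simpa only [add_smul] using (ha x).add (ha y))
        exact (congrFun this j).symm
      map_smul' := fun r x => by
        have := hau (r • x) (fun n => r * a x n)
          (by simpa only [mul_smul] using (ha x).const_smul r)
        exact (congrFun this j).symm }
  refine ⟨fun j => (f j).mkContinuous ρ (hbound j), ρ, by linarith, hbound, ?_, ha⟩
  intro x b hb j
  exact (congrFun (hau x b hb) j).symm

theorem FinitelyFactorsLpLinf.exists_finset {𝕂 : Type*} [RCLike 𝕂] {Y : Type*}
    [NormedAddCommGroup Y] [NormedSpace 𝕂 Y] {p δ : ℝ}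
    (h : FinitelyFactorsLpLinf 𝕂 Y p δ) (hδ : δ < 1) (B : Finset ℕ) :
    ∃ y : ℕ → Y, (∀ j ∈ B, 1 - δ ≤ ‖y j‖) ∧
      ∀ a : ℕ → 𝕂, ‖∑ j ∈ B, a j • y j‖ ≤ (∑ j ∈ B, ‖a j‖ ^ p) ^ (1 / p) := by
  obtain ⟨y, hy⟩ := h B.card
  classical
  let σ := B.equivFin
  let z : ℕ → Y := fun j => if hj : j ∈ B then y (σ ⟨j, hj⟩) else 0
  have hz : ∀ j : B, z j = y (σ j) := fun j => by simp [z]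
  refine ⟨z, fun j hj => ?_, fun a => ?_⟩
  · let i := σ ⟨j, hj⟩
    have h1 := (hy (Pi.single i 1)).1
    have h2 : (1 : ℝ) ≤ ⨆ k, ‖(Pi.single i 1 : Fin B.card → 𝕂) k‖ := by
      have := le_ciSup (f := fun k => ‖(Pi.single i 1 : Fin B.card → 𝕂) k‖)
        (Set.finite_range _).bddAbove i
      simpa using this
    have h3 : ∑ k, (Pi.single i 1 : Fin B.card → 𝕂) k • y k = z j := by
      rw [hz ⟨j, hj⟩, Finset.sum_eq_single i]
      · simp [i]
      · intro k _ hk; simp [hk]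
      · simp
    rw [h3] at h1
    nlinarith
  · have h1 := (hy (fun k => a (σ.symm k))).2
    rw [← σ.sum_comp, ← σ.sum_comp] at h1
    simp only [Equiv.symm_apply_apply, ← hz] at h1
    rwa [Finset.sum_coe_sort B (fun j => a j • z j),
      Finset.sum_coe_sort B (fun j => ‖a j‖ ^ p)] at h1

theorem weaklySummable_of_summable {𝕂 : Type*} [RCLike 𝕂] {X : Type*} [NormedAddCommGroup X]
    [NormedSpace 𝕂 X] {x : ℕ → X} (hx : Summable x) : WeaklySummable 𝕂 x := by
  intro φ
  exact (summable_norm_iff (f := fun j => φ (x j))).2 (φ.summable hx)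

theorem exists_disjoint_blocks_of_not_summable {f : ℕ → ℝ} (hf : ∀ n, 0 ≤ f n)
    (hns : ¬Summable f) (M : ℕ → ℝ) :
    ∃ B : ℕ → Finset ℕ, Pairwise (Function.onFun Disjoint B) ∧ ∀ k, M k ≤ ∑ j ∈ B k, f j := by
  have key : ∀ N k, ∃ N', N ≤ N' ∧ M k ≤ ∑ j ∈ Finset.Ico N N', f j := by
    intro N k
    have ht := (not_summable_iff_tendsto_nat_atTop_of_nonneg hf).1 hns
    obtain ⟨N', h1, h2⟩ := ((ht.eventually_ge_atTop (M k + ∑ j ∈ Finset.range N, f j)).and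
      (Filter.eventually_ge_atTop N)).exists
    refine ⟨N', h2, ?_⟩
    rw [Finset.sum_Ico_eq_sub _ h2]
    linarith
  choose g hg hM using key
  let n : ℕ → ℕ := fun k => Nat.rec 0 (fun k N => g N k) k
  have hmono : Monotone n := monotone_nat_of_le_succ fun k => hg _ _
  refine ⟨fun k => Finset.Ico (n k) (n (k + 1)), fun i j hij => ?_, fun k => hM _ _⟩
  have := hmono.pairwise_disjoint_on_Ico_succ hij
  rw [Function.onFun, ← Finset.disjoint_coe, Finset.coe_Ico, Finset.coe_Ico]
  exact this

theorem not_summable_of_disjoint_blocks {f : ℕ → ℝ} (hf : ∀ n, 0 ≤ f n) {B : ℕ → Finset ℕ}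
    (hB : Pairwise (Function.onFun Disjoint B)) {r : ℝ} (hr : 0 < r)
    (h : ∀ k, r ≤ ∑ j ∈ B k, f j) : ¬Summable f := by
  classical
  intro hs
  obtain ⟨K, hK⟩ := exists_nat_gt ((∑' j, f j) / r)
  have h1 : ∑ j ∈ (Finset.range K).biUnion B, f j ≤ ∑' j, f j :=
    hs.sum_le_tsum _ fun j _ => hf j
  rw [Finset.sum_biUnion fun i _ j _ hij => hB hij] at h1
  have h2 := Finset.card_nsmul_le_sum (Finset.range K) (fun k => ∑ j ∈ B k, f j) r fun k _ => h k
  rw [div_lt_iff₀ hr] at hK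
  simp only [Finset.card_range, nsmul_eq_mul] at h2
  linarith

/-- Gliding hump: a bounded family of diagonal polynomials carried by disjoint blocks of
coordinates glues to a single polynomial, so its blockwise `q`-sums cannot be large. -/
theorem not_forall_two_pow_le_block_sum {𝕂 : Type*} [RCLike 𝕂]
    {X : Type*} [NormedAddCommGroup X] [NormedSpace 𝕂 X]
    {Y : Type*} [NormedAddCommGroup Y] [NormedSpace 𝕂 Y] [CompleteSpace Y]
    {e : ℕ → X} {c : ℕ → X →L[𝕂] 𝕂}
    (hc : ∀ (x : X) (a : ℕ → 𝕂), HasSum (fun j => a j • e j) x → ∀ j, c j x = a j)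
    {m : ℕ} (hm : 0 < m) {q p δ : ℝ} (hq : 0 < q) (hp : 0 < p)
    (hδ1 : δ < 1) (hff : FinitelyFactorsLpLinf 𝕂 Y p δ)
    (hsum : ∀ P : X → Y, IsHomogPoly 𝕂 m P → ∀ x : ℕ → X, WeaklySummable 𝕂 x →
      Summable fun j => ‖P (x j)‖ ^ q)
    {B : ℕ → Finset ℕ} (hB : Pairwise (Function.onFun Disjoint B))
    {w : ℕ → ℕ → ℝ} (hw : ∀ k j, 0 ≤ w k j) {C : ℝ} (hC : 0 ≤ C)
    (hbd : ∀ k (v : Fin m → X), ∑ j ∈ B k, (w k j * ∏ i, ‖c j (v i)‖) ^ p ≤ (C * ∏ i, ‖v i‖) ^ p)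
    {x : X} {a : ℕ → 𝕂} (hx : HasSum (fun j => a j • e j) x)
    (hlarge : ∀ k : ℕ, ((2 : ℝ) ^ k) ^ q ≤ ∑ j ∈ B k, (w k j * ‖a j‖ ^ m) ^ q) : False := by
  classical
  choose y hy1 hy2 using fun k => hff.exists_finset hδ1 (B k)
  let T : ℕ → ContinuousMultilinearMap 𝕂 (fun _ : Fin m => X) Y := fun k =>
    ∑ j ∈ B k, (w k j : 𝕂) •
      ((ContinuousMultilinearMap.mkPiAlgebra 𝕂 (Fin m) 𝕂).compContinuousLinearMap
        fun _ => c j).smulRight (y k j)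
  have hT : ∀ k v, T k v = ∑ j ∈ B k, ((w k j : 𝕂) * ∏ i, c j (v i)) • y k j := by
    intro k v
    simp [T, mul_smul]
  have hTn : ∀ k, ‖T k‖ ≤ C := by
    intro k
    refine ContinuousMultilinearMap.opNorm_le_bound hC fun v => ?_
    rw [hT]
    have h0 : 0 ≤ C * ∏ i, ‖v i‖ := by positivity
    refine (hy2 k _).trans ?_
    calc _ ≤ ((C * ∏ i, ‖v i‖) ^ p) ^ (1 / p) := by
          refine Real.rpow_le_rpow (by positivity) ?_ (by positivity)
          convert hbd k v using 3 with j hj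
          simp [abs_of_nonneg (hw k j)]
      _ = _ := by rw [← Real.rpow_mul h0, mul_one_div_cancel hp.ne', Real.rpow_one]
  let U : ℕ → ContinuousMultilinearMap 𝕂 (fun _ : Fin m => X) Y := fun k =>
    (((1 / 2 : ℝ) ^ k : ℝ) : 𝕂) • T k
  have hU : Summable U := by
    refine Summable.of_norm_bounded (g := fun k : ℕ => (1 / 2 : ℝ) ^ k * C)
      (summable_geometric_two.mul_right C) fun k => ?_
    rw [norm_smul, RCLike.norm_ofReal, abs_of_nonneg (by positivity)]
    gcongr
    exact hTn k
  have hce : ∀ i j, c i (e j) = if i = j then 1 else 0 := by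
    intro i j
    refine hc (e j) (fun n => if n = j then 1 else 0) ?_ i
    convert hasSum_ite_eq j (e j) using 2 with n
    split_ifs with h <;> simp [h]
  have hTe : ∀ k j, T k (fun _ => a j • e j) =
      if j ∈ B k then ((w k j : 𝕂) * a j ^ m) • y k j else 0 := by
    intro k j
    rw [hT]
    simp only [map_smul, hce, Finset.prod_const, Finset.card_univ, Fintype.card_fin,
      smul_eq_mul, mul_ite, mul_one, mul_zero, ite_pow, zero_pow hm.ne', ite_smul, zero_smul]
    rw [Finset.sum_ite_eq']
  have heval : ∀ k, ∀ j ∈ B k, (∑' l, U l) (fun _ => a j • e j) =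
      ((((1 / 2 : ℝ) ^ k : ℝ) : 𝕂) * ((w k j : 𝕂) * a j ^ m)) • y k j := by
    intro k j hj
    rw [ContinuousMultilinearMap.tsum_eval hU, tsum_eq_single k]
    · simp only [U, smul_apply, hTe, if_pos hj, mul_smul]
    · intro l hl
      have : j ∉ B l := Finset.disjoint_left.1 (hB hl.symm) hj
      simp [U, hTe, this]
  have hs := hsum (fun x => (∑' l, U l) fun _ => x) ⟨_, fun _ => rfl⟩ _
    (weaklySummable_of_summable hx.summable)
  have hδ : 0 < 1 - δ := by linarith
  refine not_summable_of_disjoint_blocks (fun n => by positivity) hB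
    (Real.rpow_pos_of_pos hδ q) (fun k => ?_) hs
  calc (1 - δ) ^ q = ((1 - δ) * (1 / 2) ^ k) ^ q * ((2 : ℝ) ^ k) ^ q := by
        rw [← Real.mul_rpow (by positivity) (by positivity), mul_assoc, ← mul_pow]
        norm_num
    _ ≤ ((1 - δ) * (1 / 2) ^ k) ^ q * ∑ j ∈ B k, (w k j * ‖a j‖ ^ m) ^ q := by
        gcongr
        exact hlarge k
    _ ≤ _ := by
        rw [Finset.mul_sum]
        refine Finset.sum_le_sum fun j hj => ?_
        have hwk := hw k j
        rw [heval k j hj, ← Real.mul_rpow (by positivity) (by positivity), norm_smul, norm_mul,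
          norm_mul, RCLike.norm_ofReal, RCLike.norm_ofReal, abs_of_nonneg hwk, norm_pow,
          abs_of_nonneg (by positivity)]
        refine Real.rpow_le_rpow (by positivity) ?_ hq.le
        have := mul_le_mul_of_nonneg_left (hy1 k j hj)
          (show 0 ≤ (1 / 2 : ℝ) ^ k * (w k j * ‖a j‖ ^ m) by positivity)
        linarith

theorem Summable.rpow_of_le {b : ℕ → ℝ} (hb : ∀ n, 0 ≤ b n) {u v : ℝ} (hu : 0 < u) (huv : u ≤ v)
    (h : Summable fun n => b n ^ u) : Summable fun n => b n ^ v := by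
  refine h.of_norm_bounded_eventually_nat ?_
  filter_upwards [h.tendsto_atTop_zero.eventually_le_const zero_lt_one] with n hn
  have hb1 : b n ≤ 1 := by
    by_contra! hlt
    exact absurd hn (not_le.2 (Real.one_lt_rpow hlt hu))
  rw [Real.norm_of_nonneg (Real.rpow_nonneg (hb n) v)]
  exact Real.rpow_le_rpow_of_exponent_ge_of_imp (hb n) hb1 huv fun _ hv => by linarith

/-- Banach–Steinhaus for coordinates: pointwise `r`-summability is uniform. -/
theorem exists_sum_rpow_le_of_forall_summable {𝕂 : Type*} [RCLike 𝕂] {X : Type*}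
    [NormedAddCommGroup X] [NormedSpace 𝕂 X] [CompleteSpace X] (c : ℕ → X →L[𝕂] 𝕂) {r : ℝ}
    (hr : 1 ≤ r) (h : ∀ x, Summable fun j => ‖c j x‖ ^ r) :
    ∃ D : ℝ, 0 ≤ D ∧ ∀ (B : Finset ℕ) (x : X), ∑ j ∈ B, ‖c j x‖ ^ r ≤ (D * ‖x‖) ^ r := by
  classical
  have hr0 : 0 < r := by linarith
  have htr : (ENNReal.ofReal r).toReal = r := ENNReal.toReal_ofReal hr0.le
  have : Fact (1 ≤ ENNReal.ofReal r) := ⟨by simpa using ENNReal.ofReal_le_ofReal hr⟩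
  let g : Finset ℕ → X →L[𝕂] lp (fun _ : ℕ => 𝕂) (ENNReal.ofReal r) := fun B =>
    ∑ j ∈ B, (lp.singleContinuousLinearMap 𝕂 (fun _ : ℕ => 𝕂) (ENNReal.ofReal r) j).comp (c j)
  have hg : ∀ B x, ‖g B x‖ ^ r = ∑ j ∈ B, ‖c j x‖ ^ r := by
    intro B x
    have := lp.norm_sum_single (E := fun _ : ℕ => 𝕂) (p := ENNReal.ofReal r)
      (by rwa [htr]) (fun j => c j x) B
    rw [htr] at this
    rw [← this]
    simp [g]
  obtain ⟨D, hD⟩ := banach_steinhaus (g := g) fun x => ⟨(∑' j, ‖c j x‖ ^ r) ^ (1 / r), fun B => by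
    rw [one_div, Real.le_rpow_inv_iff_of_pos (norm_nonneg _)
      (tsum_nonneg fun j => by positivity) hr0, hg]
    exact (h x).sum_le_tsum _ fun j _ => by positivity⟩
  refine ⟨D, (norm_nonneg _).trans (hD ∅), fun B x => ?_⟩
  rw [← hg]
  exact Real.rpow_le_rpow (norm_nonneg _) ((g B).le_of_opNorm_le (hD B) x) hr0.le

theorem sum_prod_rpow_le {𝕂 : Type*} [RCLike 𝕂] {X : Type*}
    [NormedAddCommGroup X] [NormedSpace 𝕂 X] (c : ℕ → X →L[𝕂] 𝕂) {m : ℕ} (hm : 0 < m) {p D : ℝ}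
    (hp : 0 < p) (hD : 0 ≤ D) {B : Finset ℕ}
    (h : ∀ x : X, ∑ j ∈ B, ‖c j x‖ ^ ((m : ℝ) * p) ≤ (D * ‖x‖) ^ ((m : ℝ) * p))
    (v : Fin m → X) :
    ∑ j ∈ B, (∏ i, ‖c j (v i)‖) ^ p ≤ ((m : ℝ) ^ (1 / p) * D ^ m * ∏ i, ‖v i‖) ^ p := by
  by_cases hv : ∃ i, v i = 0
  · obtain ⟨i, hi⟩ := hv
    have : ∀ j, ∏ i, ‖c j (v i)‖ = 0 := fun j =>
      Finset.prod_eq_zero (Finset.mem_univ i) (by simp [hi])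
    simp only [this, Real.zero_rpow hp.ne', Finset.sum_const_zero]
    positivity
  push Not at hv
  have hv' : ∀ i, 0 < ‖v i‖ := fun i => norm_pos_iff.2 (hv i)
  have hmp : 0 < (m : ℝ) * p := by positivity
  have hnorm : ∀ i, ∑ j ∈ B, (‖c j (v i)‖ / ‖v i‖) ^ ((m : ℝ) * p) ≤ D ^ ((m : ℝ) * p) := by
    intro i
    have := hv' i
    simp only [Real.div_rpow (norm_nonneg _) (norm_nonneg _)]
    rw [← Finset.sum_div, div_le_iff₀ (by positivity), ← Real.mul_rpow hD (norm_nonneg _)]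
    exact h (v i)
  have hmax : ∀ j, (∏ i, ‖c j (v i)‖ / ‖v i‖) ^ p ≤
      ∑ i, (‖c j (v i)‖ / ‖v i‖) ^ ((m : ℝ) * p) := by
    intro j
    have : Nonempty (Fin m) := ⟨⟨0, hm⟩⟩
    obtain ⟨i₀, hi₀⟩ := Finite.exists_max fun i => ‖c j (v i)‖ / ‖v i‖
    calc _ ≤ ((‖c j (v i₀)‖ / ‖v i₀‖) ^ m) ^ p := by
          refine Real.rpow_le_rpow (by positivity) ?_ hp.le
          simpa [div_pow] using Finset.prod_le_prod (s := Finset.univ) (fun i _ => by positivity)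
            fun i _ => hi₀ i
      _ = (‖c j (v i₀)‖ / ‖v i₀‖) ^ ((m : ℝ) * p) := by
          rw [Real.rpow_mul (by positivity), Real.rpow_natCast]
      _ ≤ _ := Finset.single_le_sum (f := fun i => (‖c j (v i)‖ / ‖v i‖) ^ ((m : ℝ) * p))
          (fun i _ => by positivity) (Finset.mem_univ i₀)
  have hprod : 0 < ∏ i, ‖v i‖ := Finset.prod_pos fun i _ => hv' i
  calc _ = ∑ j ∈ B, (∏ i, ‖c j (v i)‖ / ‖v i‖) ^ p * (∏ i, ‖v i‖) ^ p := by
        refine Finset.sum_congr rfl fun j _ => ?_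
        rw [← Real.mul_rpow (by positivity) hprod.le, Finset.prod_div_distrib,
          div_mul_cancel₀ _ hprod.ne']
    _ ≤ (∑ j ∈ B, ∑ i, (‖c j (v i)‖ / ‖v i‖) ^ ((m : ℝ) * p)) * (∏ i, ‖v i‖) ^ p := by
        rw [← Finset.sum_mul]
        gcongr with j _
        exact hmax j
    _ ≤ (m * D ^ ((m : ℝ) * p)) * (∏ i, ‖v i‖) ^ p := by
        rw [Finset.sum_comm]
        gcongr
        simpa using Finset.sum_le_sum fun i (_ : i ∈ Finset.univ) => hnorm i
    _ = _ := by
        rw [Real.mul_rpow (by positivity) hprod.le, Real.mul_rpow (by positivity) (by positivity),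
          ← Real.rpow_mul (by positivity), one_div_mul_cancel hp.ne', Real.rpow_one,
          Real.rpow_mul hD, Real.rpow_natCast]

/-- Testing against diagonal polynomials with weights of unit `ℓ_p` norm. -/
theorem summable_coord_rpow {𝕂 : Type*} [RCLike 𝕂]
    {X : Type*} [NormedAddCommGroup X] [NormedSpace 𝕂 X]
    {Y : Type*} [NormedAddCommGroup Y] [NormedSpace 𝕂 Y] [CompleteSpace Y]
    {e : ℕ → X} {c : ℕ → X →L[𝕂] 𝕂}
    (hc : ∀ (x : X) (a : ℕ → 𝕂), HasSum (fun j => a j • e j) x → ∀ j, c j x = a j)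
    {ρ : ℝ} (hρ : 0 ≤ ρ) (hcb : ∀ j x, ‖c j x‖ ≤ ρ * ‖x‖)
    {m : ℕ} (hm : 0 < m) {q p δ : ℝ} (hq : 0 < q) (hqp : q < p)
    (hδ1 : δ < 1) (hff : FinitelyFactorsLpLinf 𝕂 Y p δ)
    (hsum : ∀ P : X → Y, IsHomogPoly 𝕂 m P → ∀ x : ℕ → X, WeaklySummable 𝕂 x →
      Summable fun j => ‖P (x j)‖ ^ q)
    {x : X} {a : ℕ → 𝕂} (hx : HasSum (fun j => a j • e j) x) :
    Summable fun j => ‖a j‖ ^ ((m : ℝ) * (p * q / (p - q))) := by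
  have hp : 0 < p := hq.trans hqp
  have hθ : 0 < 1 - q / p := by rw [sub_pos, div_lt_one hp]; exact hqp
  by_contra hns
  set s : ℕ → ℝ := fun j => ‖a j‖ ^ ((m : ℝ) * (p * q / (p - q))) with hs_def
  have hs : ∀ j, 0 ≤ s j := fun j => by positivity
  obtain ⟨B, hB, hM⟩ := exists_disjoint_blocks_of_not_summable hs hns
    fun k => (((2 : ℝ) ^ k) ^ q) ^ (1 / (1 - q / p))
  set S : ℕ → ℝ := fun k => ∑ j ∈ B k, s j with hS_def
  have hS : ∀ k, 0 < S k := fun k => lt_of_lt_of_le (by positivity) (hM k)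
  have hw : ∀ k j, 0 ≤ (s j / S k) ^ (1 / p) := fun k j =>
    Real.rpow_nonneg (div_nonneg (hs j) (hS k).le) _
  refine not_forall_two_pow_le_block_sum hc hm hq hp hδ1 hff hsum hB
    (w := fun k j => (s j / S k) ^ (1 / p)) hw (pow_nonneg hρ m) (fun k v => ?_) hx fun k => ?_
  · have hk := hS k
    calc _ ≤ ∑ j ∈ B k, s j / S k * (ρ ^ m * ∏ i, ‖v i‖) ^ p := by
          refine Finset.sum_le_sum fun j _ => ?_
          have hdiv : 0 ≤ s j / S k := div_nonneg (hs j) hk.le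
          rw [Real.mul_rpow (hw k j) (by positivity), ← Real.rpow_mul hdiv,
            one_div_mul_cancel hp.ne', Real.rpow_one]
          gcongr
          calc ∏ i, ‖c j (v i)‖ ≤ ∏ i, ρ * ‖v i‖ :=
                Finset.prod_le_prod (fun i _ => norm_nonneg _) fun i _ => hcb j (v i)
            _ = _ := by simp [Finset.prod_mul_distrib]
      _ = _ := by rw [← Finset.sum_mul, ← Finset.sum_div, div_self hk.ne', one_mul]
  · have hk := hS k
    have hterm : ∀ j, ((s j / S k) ^ (1 / p) * ‖a j‖ ^ m) ^ q = s j / S k ^ (q / p) := by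
      intro j
      have ha : (‖a j‖ ^ m) ^ q = s j ^ (1 - q / p) := by
        rw [hs_def, ← Real.rpow_mul (norm_nonneg _), ← Real.rpow_natCast,
          ← Real.rpow_mul (norm_nonneg _)]
        congr 1
        have : p - q ≠ 0 := by linarith
        field_simp
      rw [Real.mul_rpow (hw k j) (by positivity), ha,
        ← Real.rpow_mul (div_nonneg (hs j) hk.le), Real.div_rpow (hs j) hk.le, one_div_mul_eq_div,
        div_mul_eq_mul_div, ← Real.rpow_add_of_nonneg (hs j) (by positivity) hθ.le]
      simp
    simp only [hterm]
    rw [← Finset.sum_div]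
    calc ((2 : ℝ) ^ k) ^ q = ((((2 : ℝ) ^ k) ^ q) ^ (1 / (1 - q / p))) ^ (1 - q / p) := by
          rw [← Real.rpow_mul (by positivity), one_div_mul_cancel hθ.ne', Real.rpow_one]
      _ ≤ S k ^ (1 - q / p) := Real.rpow_le_rpow (by positivity) (hM k) hθ.le
      _ = _ := by rw [Real.rpow_sub hk, Real.rpow_one]

/-- Pellegrino: if `Y` finitely factors `ℓ_p → ℓ_∞` and every continuous `m`-homogeneous
polynomial from `X` into `Y` is absolutely `(q;1)`-summing, then (a) if `q < p`, the basis
coefficients of every `x ∈ X` are `mt`-summable for all `t > pq/(p-q)`; (b) if `q ≤ p/2`,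
the same holds for all `t > q`. -/
theorem stmt9 (𝕂 : Type*) [RCLike 𝕂]
    (X : Type*) [NormedAddCommGroup X] [NormedSpace 𝕂 X] [CompleteSpace X]
    (Y : Type*) [NormedAddCommGroup Y] [NormedSpace 𝕂 Y] [CompleteSpace Y]
    (hX : ¬FiniteDimensional 𝕂 X) (hY : ¬FiniteDimensional 𝕂 Y)
    (e : ℕ → X) (he : IsNormalizedUncondBasis 𝕂 X e)
    (m : ℕ) (hm : 0 < m) (q p δ : ℝ) (hq : 0 < q) (hp : 1 ≤ p)
    (hδ0 : 0 < δ) (hδ1 : δ < 1) (hff : FinitelyFactorsLpLinf 𝕂 Y p δ)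
    (hsum : ∀ P : X → Y, IsHomogPoly 𝕂 m P → ∀ x : ℕ → X, WeaklySummable 𝕂 x →
      Summable fun j => ‖P (x j)‖ ^ q) :
    (q < p → ∀ t : ℝ, p * q / (p - q) < t → ∀ (x : X) (a : ℕ → 𝕂),
      HasSum (fun j => a j • e j) x → Summable fun j => ‖a j‖ ^ ((m : ℝ) * t)) ∧
    (q ≤ p / 2 → ∀ t : ℝ, q < t → ∀ (x : X) (a : ℕ → 𝕂),
      HasSum (fun j => a j • e j) x → Summable fun j => ‖a j‖ ^ ((m : ℝ) * t)) := by
  obtain ⟨c, ρ, hρ, hcb, hc, hcs⟩ := he.exists_coord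
  have hm' : (1 : ℝ) ≤ m := by exact_mod_cast hm
  have hm0 : (0 : ℝ) < m := by linarith
  have hp0 : 0 < p := by linarith
  refine ⟨fun hqp t ht x a hx => ?_, fun hqp t ht x a hx => ?_⟩
  · have hpq : 0 < p - q := by linarith
    exact (summable_coord_rpow hc hρ hcb hm hq hqp hδ1 hff hsum hx).rpow_of_le
      (fun _ => norm_nonneg _) (by positivity) (by gcongr)
  · have hpq : 0 < p - q := by linarith
    have hle : p * q / (p - q) ≤ p := by
      rw [div_le_iff₀ hpq]
      nlinarith
    obtain ⟨D, hD, hDb⟩ := exists_sum_rpow_le_of_forall_summable c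
      (r := (m : ℝ) * p) (by nlinarith) fun z =>
        (summable_coord_rpow hc hρ hcb hm hq (by linarith) hδ1 hff hsum (hcs z)).rpow_of_le
          (fun _ => norm_nonneg _) (by positivity) (by gcongr)
    refine Summable.rpow_of_le (u := (m : ℝ) * q) (fun _ => norm_nonneg _) (by positivity)
      (by gcongr) ?_
    by_contra hns
    obtain ⟨B, hB, hM⟩ := exists_disjoint_blocks_of_not_summable
      (fun j => by positivity) hns fun k => ((2 : ℝ) ^ k) ^ q
    refine not_forall_two_pow_le_block_sum hc hm hq hp0 hδ1 hff hsum hB (w := fun _ _ => 1)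
      (fun _ _ => zero_le_one) (C := (m : ℝ) ^ (1 / p) * D ^ m) (by positivity)
      (fun k v => ?_) hx fun k => ?_
    · simpa only [one_mul] using sum_prod_rpow_le c hm hp0 hD (hDb (B k)) v
    · refine (hM k).trans_eq (Finset.sum_congr rfl fun j _ => ?_)
      rw [one_mul, Real.rpow_mul (norm_nonneg _), Real.rpow_natCast]
end

section
/- Let Y be a Banach space for which there exist constants C₁, C₂ > 0 and p ≥ 1 such that for every n ∈ ℕ there are y₁,…,y_n ∈ Y with ‖y_j‖ ≥ C₁ for every j and ‖∑_{j=1}^n a_j y_j‖ ≤ C₂ (∑_{j=1}^n |a_j|^p)^{1/p} for all scalars a₁,…,a_n. Let X₁,…,X_m be Banach spaces such that X_k has a normalized unconditional Schauder basis (x_n^{(k)}) for each k = 1,…,m, let n₁,…,n_m ≥ 1, and let 0 < q < p. If every continuous (n₁,…,n_m)-homogeneous polynomial from X₁ × ⋯ × X_m into Y is absolutely (q;1)-summing, then for every t > pq/(p−q) and all x_k = ∑_j a_j^{(k)} x_j^{(k)} ∈ X_k (k = 1,…,m) one has ∑_j (∏_{k=1}^m |a_j^{(k)}|^{n_k})^t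 < ∞. -/
open scoped BigOperators

/-- `P` is a continuous `(n 0, …, n (m-1))`-homogeneous polynomial, i.e. it comes from a
continuous multilinear map in `n 0 + ⋯ + n (m-1)` variables (`n k` copies of `X k`). -/
def IsMultiPoly (𝕂 : Type*) [RCLike 𝕂] {m : ℕ} (n : Fin m → ℕ)
    {X : Fin m → Type*} [∀ k, NormedAddCommGroup (X k)] [∀ k, NormedSpace 𝕂 (X k)]
    {Y : Type*} [NormedAddCommGroup Y] [NormedSpace 𝕂 Y]
    (P : (∀ k, X k) → Y) : Prop :=
  ∃ T : ContinuousMultilinearMap 𝕂 (fun i : Σ k : Fin m, Fin (n k) => X i.1) Y,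
    ∀ x : ∀ k, X k, P x = T fun i => x i.1

/-- The coordinate functionals of a normalized unconditional basis are continuous and uniformly
bounded. -/
theorem IsNormalizedUncondBasis.exists_coord_s13 {𝕂 : Type*} [RCLike 𝕂] {X : Type*}
    [NormedAddCommGroup X] [NormedSpace 𝕂 X] {e : ℕ → X} (h : IsNormalizedUncondBasis 𝕂 X e) :
    ∃ (f : ℕ → X →L[𝕂] 𝕂) (M : ℝ), 0 ≤ M ∧ (∀ j, ‖f j‖ ≤ M) ∧
      ∀ i j, f j (e i) = if i = j then 1 else 0 := by
  obtain ⟨h1, h2, ρ, hρ, h3⟩ := h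
  choose c hc hcu using h2
  have hadd (x y : X) : c (x + y) = c x + c y := by
    refine (hcu _ _ ?_).symm
    simpa [add_smul] using (hc x).add (hc y)
  have hsmul (r : 𝕂) (x : X) : c (r • x) = r • c x := by
    refine (hcu _ _ ?_).symm
    simpa [mul_smul] using (hc x).const_smul r
  have hbound (j : ℕ) (x : X) : ‖c x j‖ ≤ ρ * ‖x‖ := by
    have hy : HasSum (fun n => ((if n = j then (-1 : 𝕂) else 1) * c x n) • e n)
        (x - (2 * c x j) • e j) := by
      convert (hc x).sub (hasSum_ite_eq j ((2 * c x j) • e j)) using 2 with n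
      by_cases hn : n = j
      · subst hn
        simp only [if_true, ← sub_smul]
        congr 1
        ring
      · simp [hn]
    have h4 := h3 (c x) (fun n => if n = j then (-1 : 𝕂) else 1) x _
      (fun n => by by_cases hn : n = j <;> simp [hn]) (hc x) hy
    have h5 : ‖(2 * c x j) • e j‖ ≤ ‖x‖ + ‖x - (2 * c x j) • e j‖ := by
      simpa using norm_sub_le x (x - (2 * c x j) • e j)
    rw [norm_smul, h1, norm_mul, RCLike.norm_two] at h5
    nlinarith [norm_nonneg x]
  refine ⟨fun j => LinearMap.mkContinuous
    { toFun := fun x => c x j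
      map_add' := fun x y => by simp [hadd]
      map_smul' := fun r x => by simp [hsmul] } ρ (hbound j), ρ, by linarith,
    fun j => LinearMap.mkContinuous_norm_le _ (by linarith) _, fun i j => ?_⟩
  have : (fun n => if i = n then (1 : 𝕂) else 0) = c (e i) := by
    refine hcu _ _ ?_
    convert hasSum_ite_eq i (e i) using 2 with n
    by_cases hn : n = i
    · simp [hn]
    · simp [hn, Ne.symm hn]
  simp [← this]

/-- A divergent series of nonnegative terms splits into consecutive blocks whose sums exceed
prescribed bounds. -/
theorem exists_monotone_le_sum_Ico {u : ℕ → ℝ} (hu : ∀ j, 0 ≤ u j) (hs : ¬ Summable u)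
    (R : ℕ → ℝ) :
    ∃ N : ℕ → ℕ, Monotone N ∧ ∀ i, R i ≤ ∑ j ∈ Finset.Ico (N i) (N (i + 1)), u j := by
  have key (i k : ℕ) : ∃ l, k ≤ l ∧ R i ≤ ∑ j ∈ Finset.Ico k l, u j := by
    have ht := (not_summable_iff_tendsto_nat_atTop_of_nonneg hu).1 hs
    obtain ⟨l, hl, hkl⟩ := ((ht.eventually_ge_atTop (R i + ∑ j ∈ Finset.range k, u j)).and
      (Filter.eventually_ge_atTop k)).exists
    refine ⟨l, hkl, ?_⟩
    rw [Finset.sum_Ico_eq_sub _ hkl]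
    linarith
  choose g hg hR using key
  let N : ℕ → ℕ := fun i => Nat.rec 0 (fun i k => g i k) i
  exact ⟨N, monotone_nat_of_le_succ fun i => hg i (N i), fun i => hR i (N i)⟩

/-- A block-diagonal continuous multilinear map attached to a finite family satisfying an upper
`p`-estimate. -/
theorem exists_diagonal_multilinear {𝕂 : Type*} [RCLike 𝕂] {ι : Type*} [Fintype ι] [Nonempty ι]
    {E : ι → Type*} [∀ i, NormedAddCommGroup (E i)] [∀ i, NormedSpace 𝕂 (E i)]
    {Y : Type*} [NormedAddCommGroup Y] [NormedSpace 𝕂 Y] {C p : ℝ} (hC : 0 ≤ C) (hp : 0 < p)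
    (f : ∀ i, ℕ → E i →L[𝕂] 𝕂) (M : ι → ℝ) (hM : ∀ i, 0 ≤ M i) (hf : ∀ i j, ‖f i j‖ ≤ M i)
    (s : Finset ℕ) (y : s → Y)
    (hy : ∀ a : s → 𝕂, ‖∑ j, a j • y j‖ ≤ C * (∑ j, ‖a j‖ ^ p) ^ (1 / p))
    (w : ℕ → ℝ) (hw : ∀ j, 0 ≤ w j) (hws : ∑ j ∈ s, w j ^ p ≤ 1) :
    ∃ T : ContinuousMultilinearMap 𝕂 E Y, ‖T‖ ≤ C * ∏ i, M i ∧
      ∀ (v : ∀ i, E i) (α : ι → 𝕂) (l : ℕ),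
        (∀ i j, f i j (v i) = if l = j then α i else 0) →
        (l ∉ s → T v = 0) ∧ ∀ h : l ∈ s, T v = ((w l : 𝕂) * ∏ i, α i) • y ⟨l, h⟩ := by
  let T : ContinuousMultilinearMap 𝕂 E Y := ∑ j : s, (w j : 𝕂) •
    ((ContinuousMultilinearMap.mkPiAlgebra 𝕂 ι 𝕂).compContinuousLinearMap
      fun i => f i j).smulRight (y j)
  have hT (v : ∀ i, E i) : T v = ∑ j : s, ((w j : 𝕂) * ∏ i, f i j (v i)) • y j := by
    simp [T, mul_smul]
  refine ⟨T, ContinuousMultilinearMap.opNorm_le_bound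
    (mul_nonneg hC (Finset.prod_nonneg fun i _ => hM i)) fun v => ?_, fun v α l hv => ?_⟩
  · rw [hT, mul_assoc]
    refine (hy _).trans (mul_le_mul_of_nonneg_left ?_ hC)
    have hB : 0 ≤ (∏ i, M i) * ∏ i, ‖v i‖ :=
      mul_nonneg (Finset.prod_nonneg fun i _ => hM i) (by positivity)
    have h1 (j : s) : ‖(w j : 𝕂) * ∏ i, f i j (v i)‖ ^ p
        ≤ w j ^ p * ((∏ i, M i) * ∏ i, ‖v i‖) ^ p := by
      rw [← Real.mul_rpow (hw j) hB]
      refine Real.rpow_le_rpow (norm_nonneg _) ?_ hp.le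
      rw [norm_mul, RCLike.norm_ofReal, abs_of_nonneg (hw j), norm_prod, ← Finset.prod_mul_distrib]
      refine mul_le_mul_of_nonneg_left ?_ (hw j)
      exact Finset.prod_le_prod (fun i _ => norm_nonneg _)
        fun i _ => (f i j).le_of_opNorm_le (hf i j) _
    have h2 : ∑ j : s, ‖(w j : 𝕂) * ∏ i, f i j (v i)‖ ^ p
        ≤ ((∏ i, M i) * ∏ i, ‖v i‖) ^ p := by
      refine (Finset.sum_le_sum fun j _ => h1 j).trans ?_
      rw [← Finset.sum_mul, Finset.sum_coe_sort s fun j => w j ^ p]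
      exact mul_le_of_le_one_left (by positivity) hws
    calc _ ≤ (((∏ i, M i) * ∏ i, ‖v i‖) ^ p) ^ (1 / p) :=
          Real.rpow_le_rpow (by positivity) h2 (by positivity)
      _ = _ := by rw [one_div, Real.rpow_rpow_inv hB hp.ne']
  · have h0 (j : s) (hj : l ≠ j) : ((w j : 𝕂) * ∏ i, f i j (v i)) • y j = 0 := by
      have : ∏ i, f i j (v i) = 0 :=
        Finset.prod_eq_zero (Finset.mem_univ (Classical.arbitrary ι)) (by rw [hv, if_neg hj])
      simp [this]
    refine ⟨fun hl => ?_, fun hl => ?_⟩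
    · rw [hT]
      exact Finset.sum_eq_zero fun j _ => h0 j fun hlj => hl (hlj ▸ j.2)
    · rw [hT, Finset.sum_eq_single ⟨l, hl⟩]
      · simp [hv]
      · exact fun j _ hj => h0 j fun hlj => hj (Subtype.ext hlj.symm)
      · simp

/-- Weights realizing the duality between `ℓ_{p/q}` and its conjugate on a finite set. -/
theorem exists_weight {b : ℕ → ℝ} (hb : ∀ j, 0 ≤ b j) {p q A : ℝ} (hq : 0 < q) (hqp : q < p)
    (hA : 0 < A) (s : Finset ℕ) (hs : A ^ (p * q / (p - q)) ≤ ∑ j ∈ s, b j ^ (p * q / (p - q))) :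
    ∃ w : ℕ → ℝ, (∀ j, 0 ≤ w j) ∧ ∑ j ∈ s, w j ^ p ≤ 1 ∧
      A ^ q ≤ ∑ j ∈ s, (w j * b j) ^ q := by
  have hp : 0 < p := hq.trans hqp
  have hpq : 0 < p - q := sub_pos.2 hqp
  set r := p * q / (p - q) with hr
  have hr0 : 0 < r := by positivity
  set S := ∑ j ∈ s, b j ^ r
  have hS : 0 < S := (Real.rpow_pos_of_pos hA r).trans_le hs
  have hw (j : ℕ) : 0 ≤ b j ^ r / S := div_nonneg (Real.rpow_nonneg (hb j) r) hS.le
  refine ⟨fun j => (b j ^ r / S) ^ p⁻¹, fun j => Real.rpow_nonneg (hw j) _, ?_, ?_⟩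
  · simp only [Real.rpow_inv_rpow (hw _) hp.ne', ← Finset.sum_div]
    exact (div_self hS.ne').le
  · have h1 (j : ℕ) : ((b j ^ r / S) ^ p⁻¹ * b j) ^ q = b j ^ r / S ^ (q / p) := by
      rw [Real.mul_rpow (Real.rpow_nonneg (hw j) _) (hb j), ← Real.rpow_mul (hw j),
        Real.div_rpow (Real.rpow_nonneg (hb j) r) hS.le, ← Real.rpow_mul (hb j), div_mul_eq_mul_div,
        ← Real.rpow_add_of_nonneg (hb j) (by positivity) hq.le, inv_mul_eq_div]
      congr 2
      rw [hr]
      field_simp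
      ring
    simp only [h1, ← Finset.sum_div]
    have h2 : S / S ^ (q / p) = S ^ (1 - q / p) := by
      rw [Real.rpow_sub hS, Real.rpow_one]
    have h3 : r * (1 - q / p) = q := by
      rw [hr]
      field_simp
    calc A ^ q = (A ^ r) ^ (1 - q / p) := by rw [← Real.rpow_mul hA.le, h3]
      _ ≤ S ^ (1 - q / p) := Real.rpow_le_rpow (by positivity) hs
          (sub_nonneg.2 ((div_le_one hp).2 hqp.le))
      _ = _ := h2.symm

/-- Powers of a summable sequence with a larger exponent are summable. -/
theorem Summable.rpow_of_exponent_lt {b : ℕ → ℝ} (hb : ∀ j, 0 ≤ b j) {r t : ℝ} (hr : 0 < r)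
    (hrt : r < t) (h : Summable fun j => b j ^ r) : Summable fun j => b j ^ t := by
  refine h.of_norm_bounded_eventually_nat ?_
  filter_upwards [h.tendsto_atTop_zero.eventually_le_const one_pos] with j hj
  rw [Real.norm_of_nonneg (Real.rpow_nonneg (hb j) t)]
  have hb1 : b j ≤ 1 := by
    by_contra! hc
    exact hj.not_gt (Real.one_lt_rpow hc hr)
  rcases (hb j).eq_or_lt with h0 | h0
  · rw [← h0, Real.zero_rpow hr.ne', Real.zero_rpow (hr.trans hrt).ne']
  · exact Real.rpow_le_rpow_of_exponent_ge h0 hb1 hrt.le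

/-- Under the stated condition on `Y`, if `q < p` and every continuous
`(n₁,…,n_m)`-homogeneous polynomial into `Y` is absolutely `(q;1)`-summing, then the products
of powers of basis coefficients are `t`-summable for every `t > pq/(p-q)`. -/
theorem stmt13 (𝕂 : Type*) [RCLike 𝕂]
    (Y : Type*) [NormedAddCommGroup Y] [NormedSpace 𝕂 Y] [CompleteSpace Y]
    (C₁ C₂ p : ℝ) (hC₁ : 0 < C₁) (hC₂ : 0 < C₂) (hp : 1 ≤ p)
    (hY : ∀ N : ℕ, ∃ y : Fin N → Y, (∀ j, C₁ ≤ ‖y j‖) ∧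
      ∀ a : Fin N → 𝕂, ‖∑ j, a j • y j‖ ≤ C₂ * (∑ j, ‖a j‖ ^ p) ^ (1 / p))
    (m : ℕ) (hm : 0 < m) (n : Fin m → ℕ) (hn : ∀ k, 1 ≤ n k)
    (X : Fin m → Type*) [∀ k, NormedAddCommGroup (X k)]
    [∀ k, NormedSpace 𝕂 (X k)] [∀ k, CompleteSpace (X k)]
    (e : ∀ k, ℕ → X k) (he : ∀ k, IsNormalizedUncondBasis 𝕂 (X k) (e k))
    (q : ℝ) (hq : 0 < q) (hqp : q < p)
    (hsum : ∀ P : (∀ k, X k) → Y, IsMultiPoly 𝕂 n P →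
      ∀ x : ∀ k, ℕ → X k, (∀ k, WeaklySummable 𝕂 (x k)) →
        Summable fun j => ‖P fun k => x k j‖ ^ q)
    (t : ℝ) (ht : p * q / (p - q) < t) (x : ∀ k, X k) (a : ∀ _ : Fin m, ℕ → 𝕂)
    (ha : ∀ k, HasSum (fun j => a k j • e k j) (x k)) :
    Summable fun j => (∏ k, ‖a k j‖ ^ (n k : ℝ)) ^ t := by
  have hp0 : 0 < p := hq.trans hqp
  have hr0 : 0 < p * q / (p - q) := div_pos (mul_pos hp0 hq) (sub_pos.2 hqp)
  let b : ℕ → ℝ := fun j => ∏ k, ‖a k j‖ ^ (n k : ℝ)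
  have hb (j : ℕ) : 0 ≤ b j := Finset.prod_nonneg fun k _ => Real.rpow_nonneg (norm_nonneg _) _
  refine Summable.rpow_of_exponent_lt hb hr0 ht ?_
  by_contra hns
  obtain ⟨N, hN, hNs⟩ := exists_monotone_le_sum_Ico (fun j => Real.rpow_nonneg (hb j) _) hns
    fun i => ((2 : ℝ) ^ i) ^ (p * q / (p - q))
  choose w hw hws hwb using fun i =>
    exists_weight hb hq hqp (pow_pos two_pos i) (Finset.Ico (N i) (N (i + 1))) (hNs i)
  choose f M hM hfM hf using fun k => (he k).exists_coord_s13
  have hY' (s : Finset ℕ) : ∃ y : s → Y, (∀ j, C₁ ≤ ‖y j‖) ∧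
      ∀ a : s → 𝕂, ‖∑ j, a j • y j‖ ≤ C₂ * (∑ j, ‖a j‖ ^ p) ^ (1 / p) := by
    obtain ⟨y, hy, hya⟩ := hY s.card
    refine ⟨fun j => y (s.equivFin j), fun j => hy _, fun a => ?_⟩
    convert hya fun j => a (s.equivFin.symm j) using 3
    · rw [← Equiv.sum_comp s.equivFin]
      simp
    · rw [← Equiv.sum_comp s.equivFin]
      simp
  choose y hyC hy using hY'
  have : Nonempty (Σ k : Fin m, Fin (n k)) := ⟨⟨⟨0, hm⟩, ⟨0, hn _⟩⟩⟩
  choose T hTn hT using fun i => exists_diagonal_multilinear hC₂.le hp0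
    (fun σ : Σ k : Fin m, Fin (n k) => f σ.1) (fun σ => M σ.1) (fun σ => hM σ.1)
    (fun σ => hfM σ.1) (Finset.Ico (N i) (N (i + 1))) (y _) (hy _) (w i) (hw i) (hws i)
  have hTs : Summable fun i => (((1 / 2 : ℝ) ^ i : ℝ) : 𝕂) • T i := by
    refine Summable.of_norm_bounded
      (summable_geometric_two.mul_right (C₂ * ∏ σ : Σ k : Fin m, Fin (n k), M σ.1)) fun i => ?_
    rw [norm_smul, RCLike.norm_ofReal, abs_of_nonneg (by positivity)]
    exact mul_le_mul_of_nonneg_left (hTn i) (by positivity)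
  let Q : ContinuousMultilinearMap 𝕂 (fun σ : Σ k : Fin m, Fin (n k) => X σ.1) Y :=
    ∑' i, (((1 / 2 : ℝ) ^ i : ℝ) : 𝕂) • T i
  let v : ℕ → ∀ σ : Σ k : Fin m, Fin (n k), X σ.1 := fun l σ => a σ.1 l • e σ.1 l
  have hv (l : ℕ) (σ : Σ k : Fin m, Fin (n k)) (j : ℕ) :
      f σ.1 j (v l σ) = if l = j then a σ.1 l else 0 := by
    simp [v, hf]
  have hQ (i l : ℕ) (hl : l ∈ Finset.Ico (N i) (N (i + 1))) :
      C₁ * ((1 / 2) ^ i * (w i l * b l)) ≤ ‖Q (v l)‖ := by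
    have h1 : HasSum (fun i => ((((1 / 2 : ℝ) ^ i : ℝ) : 𝕂) • T i) (v l)) (Q (v l)) :=
      ContinuousMultilinearMap.hasSum_eval hTs.hasSum (v l)
    have h2 : Q (v l) = ((((1 / 2 : ℝ) ^ i : ℝ) : 𝕂) • T i) (v l) := by
      refine h1.unique (hasSum_single i fun i' hi' => ?_)
      have : l ∉ Finset.Ico (N i') (N (i' + 1)) := fun hl' => by
        have hd := hN.pairwise_disjoint_on_Ico_succ hi'
        exact Set.disjoint_left.1 hd (Finset.mem_Ico.1 hl') (Finset.mem_Ico.1 hl)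
      rw [smul_apply, (hT i' _ _ l (hv l)).1 this, smul_zero]
    have h3 : ‖∏ σ : Σ k : Fin m, Fin (n k), a σ.1 l‖ = b l := by
      simp [b, Fintype.prod_sigma, norm_prod]
    rw [h2, smul_apply, (hT i _ _ l (hv l)).2 hl, norm_smul, norm_smul,
      norm_mul, h3, RCLike.norm_ofReal, RCLike.norm_ofReal, abs_of_nonneg (hw i l),
      abs_of_nonneg (by positivity), mul_comm C₁, ← mul_assoc _ (w i l * b l) ‖_‖]
    exact mul_le_mul_of_nonneg_left (hyC _ _)
      (mul_nonneg (by positivity) (mul_nonneg (hw i l) (hb l)))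
  have hQs : Summable fun l => ‖Q (v l)‖ ^ q := by
    refine hsum (fun x => Q fun σ => x σ.1) ⟨Q, fun _ => rfl⟩ (fun k j => a k j • e k j)
      fun k φ => ?_
    exact summable_norm_iff.2 ((ha k).mapL φ).summable
  have hblock (i : ℕ) : C₁ ^ q ≤ ∑ l ∈ Finset.Ico (N i) (N (i + 1)), ‖Q (v l)‖ ^ q := by
    have h1 : ((1 / 2 : ℝ) ^ i) ^ q * ((2 : ℝ) ^ i) ^ q = 1 := by
      rw [← Real.mul_rpow (by positivity) (by positivity), ← mul_pow]
      simp
    calc C₁ ^ q = C₁ ^ q * ((1 / 2 : ℝ) ^ i) ^ q * ((2 : ℝ) ^ i) ^ q := by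
          rw [mul_assoc, h1, mul_one]
      _ ≤ C₁ ^ q * ((1 / 2 : ℝ) ^ i) ^ q *
          ∑ l ∈ Finset.Ico (N i) (N (i + 1)), (w i l * b l) ^ q :=
        mul_le_mul_of_nonneg_left (hwb i) (by positivity)
      _ ≤ _ := by
        rw [Finset.mul_sum]
        refine Finset.sum_le_sum fun l hl => ?_
        have hwl : 0 ≤ w i l * b l := mul_nonneg (hw i l) (hb l)
        rw [mul_assoc, ← Real.mul_rpow (by positivity) hwl,
          ← Real.mul_rpow hC₁.le (by positivity)]
        exact Real.rpow_le_rpow (by positivity) (hQ i l hl) hq.le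
  have hgrow (i : ℕ) : i * C₁ ^ q ≤ ∑ l ∈ Finset.range (N i), ‖Q (v l)‖ ^ q := by
    induction i with
    | zero =>
      rw [Nat.cast_zero, zero_mul]
      positivity
    | succ i ih =>
      rw [← Finset.sum_range_add_sum_Ico _ (hN i.le_succ)]
      push_cast
      linarith [hblock i]
  obtain ⟨i, hi⟩ := exists_nat_gt ((∑' l, ‖Q (v l)‖ ^ q) / C₁ ^ q)
  rw [div_lt_iff₀ (Real.rpow_pos_of_pos hC₁ q)] at hi
  exact absurd ((hgrow i).trans (hQs.sum_le_tsum _ fun l _ => by positivity)) hi.not_ge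
end
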